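/- Let s ≥ 4 be an integer and let G be a finite simple connected graph such that: (1) every vertex of G has degree at least 2 and at most s, and for every edge e of G the graph G − e has a vertex of degree less than 2 (i.e., G is minimal in the class of graphs with all degrees between 2 and s); (2) λ(G) < v(G)/(s+1); and (3) every graph G' with all vertex degrees between 2 and s and with v(G') < v(G) satisfies λ(G') ≥ v(G')/(s+1). Then every thread of G has either 2 or 3 edges. -/

import Mathlib

/-- `H` is a path with `k` edges (a "k-edge path"), as a subgraph of `G`. -/
def SimpleGraph.Subgraph.IsKEdgePath {V : Type*} {G : SimpleGraph V}
    (H : G.Subgraph) (k : ℕ) : Prop :=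
  ∃ (u v : V) (w : G.Walk u v), w.IsPath ∧ w.length = k ∧ H = w.toSubgraph

/-- `H` is a tree with `k` edges (a "k-edge tree"), as a subgraph of `G`. -/
def SimpleGraph.Subgraph.IsKEdgeTree {V : Type*} {G : SimpleGraph V}
    (H : G.Subgraph) (k : ℕ) : Prop :=
  H.coe.IsTree ∧ H.edgeSet.ncard = k

/-- The maximum number of pairwise vertex-disjoint `k`-edge paths in `G`. -/
noncomputable def SimpleGraph.lambdaK {V : Type*} (G : SimpleGraph V) (k : ℕ) : ℕ :=
  sSup {n | ∃ P : Finset G.Subgraph,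
    (∀ H ∈ P, H.IsKEdgePath k) ∧
    (P : Set G.Subgraph).Pairwise (fun H H' => Disjoint H.verts H'.verts) ∧
    P.card = n}

/-- The maximum number of pairwise vertex-disjoint `k`-edge trees in `G`. -/
noncomputable def SimpleGraph.tauK {V : Type*} (G : SimpleGraph V) (k : ℕ) : ℕ :=
  sSup {n | ∃ P : Finset G.Subgraph,
    (∀ H ∈ P, H.IsKEdgeTree k) ∧
    (P : Set G.Subgraph).Pairwise (fun H H' => Disjoint H.verts H'.verts) ∧
    P.card = n}

/-- A path-thread of `G`: a maximal path in `G` such that every vertex having degree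
two in the path also has degree two in `G`. -/
def SimpleGraph.IsPathThread {V : Type*} (G : SimpleGraph V) {x y : V}
    (w : G.Walk x y) : Prop :=
  w.IsPath ∧
  (∀ v : V, (w.toSubgraph.neighborSet v).ncard = 2 → (G.neighborSet v).ncard = 2) ∧
  ∀ (x' y' : V) (w' : G.Walk x' y'), w'.IsPath →
    (∀ v : V, (w'.toSubgraph.neighborSet v).ncard = 2 → (G.neighborSet v).ncard = 2) →
    w.toSubgraph ≤ w'.toSubgraph → w.toSubgraph = w'.toSubgraph

/-- A thread of `G` with end-vertices `x` and `y` (possibly `x = y`): either a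
path-thread, or (when `y = x`) a cycle-thread, i.e. a cycle all of whose vertices
except the distinguished vertex `x` have degree two in `G`. -/
def SimpleGraph.IsThread {V : Type*} (G : SimpleGraph V) {x y : V}
    (w : G.Walk x y) : Prop :=
  G.IsPathThread w ∨
  ∃ h : y = x, (w.copy rfl h).IsCycle ∧
    ∀ v ∈ w.support, v ≠ x → (G.neighborSet v).ncard = 2

inductive PackT {V : Type} (G : SimpleGraph V) : Set V → ℕ → Prop
  | nil (S : Set V) : PackT G S 0
  | cons {S S' : Set V} {n : ℕ} {a b c : V} : PackT G S n → G.Adj a b → G.Adj b c → a ≠ c →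
      a ∉ S → b ∉ S → c ∉ S → S ⊆ S' → a ∈ S' → b ∈ S' → c ∈ S' → PackT G S' (n + 1)

theorem PackT.mono {V : Type} {G : SimpleGraph V} {S T : Set V} {n : ℕ} (h : PackT G S n)
    (hST : S ⊆ T) : PackT G T n := by
  cases h with
  | nil => exact .nil _
  | cons h hab hbc hac ha hb hc hs ha' hb' hc' =>
    exact .cons h hab hbc hac ha hb hc (hs.trans hST) (hST ha') (hST hb') (hST hc')

theorem PackT.union {V : Type} {G : SimpleGraph V} {S T : Set V} {n m : ℕ} (h : PackT G S n)
    (h2 : PackT G T m) (hd : Disjoint S T) : PackT G (S ∪ T) (n + m) := by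
  induction h2 with
  | nil => exact h.mono Set.subset_union_left
  | @cons T T' m a b c h2 hab hbc hac ha hb hc hs ha' hb' hc' ih =>
    have hd' := Set.disjoint_right.1 hd
    refine .cons (ih (hd.mono_right hs)) hab hbc hac ?_ ?_ ?_
      (Set.union_subset_union_right _ hs) (Or.inr ha') (Or.inr hb') (Or.inr hc')
    · rintro (h | h); exacts [hd' ha' h, ha h]
    · rintro (h | h); exacts [hd' hb' h, hb h]
    · rintro (h | h); exacts [hd' hc' h, hc h]

theorem PackT.map {V W : Type} {G : SimpleGraph V} {G' : SimpleGraph W} (f : G ↪g G')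
    {S : Set V} {n : ℕ} (h : PackT G S n) : PackT G' (f '' S) n := by
  induction h with
  | nil => exact .nil _
  | cons h2 hab hbc hac ha hb hc hs ha' hb' hc' ih =>
    have key : ∀ {x : V} {S : Set V}, x ∉ S → f x ∉ f '' S := by
      intro x S hx h
      exact hx ((f.injective.mem_set_image).1 h)
    exact .cons ih (f.map_adj_iff.2 hab) (f.map_adj_iff.2 hbc) (fun h => hac (f.injective h))
      (key ha) (key hb) (key hc) (Set.image_mono hs)
      ⟨_, ha', rfl⟩ ⟨_, hb', rfl⟩ ⟨_, hc', rfl⟩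

theorem bdd_lambda {V : Type} [Fintype V] (G : SimpleGraph V) :
    BddAbove {n | ∃ P : Finset G.Subgraph,
    (∀ H ∈ P, H.IsKEdgePath 2) ∧
    (P : Set G.Subgraph).Pairwise (fun H H' => Disjoint H.verts H'.verts) ∧
    P.card = n} := by
  classical
  have : Finite G.Subgraph := inferInstance
  have := Fintype.ofFinite G.Subgraph
  refine ⟨Fintype.card G.Subgraph, ?_⟩
  rintro n ⟨P, -, -, rfl⟩
  exact Finset.card_le_univ P

theorem PackT.le_lambda {V : Type} [Fintype V] {G : SimpleGraph V} {S : Set V} {n : ℕ}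
    (h : PackT G S n) : n ≤ G.lambdaK 2 := by
  classical
  have hpi : ∀ (P : Finset G.Subgraph) (H : G.Subgraph),
      (insert H (P : Set G.Subgraph)).Pairwise (fun H H' => Disjoint H.verts H'.verts) ↔
      (P : Set G.Subgraph).Pairwise (fun H H' => Disjoint H.verts H'.verts) ∧
      ∀ H' ∈ (P : Set G.Subgraph), H ≠ H' → Disjoint H.verts H'.verts := by
    intro P H
    have : Std.Symm (fun H H' : G.Subgraph => Disjoint H.verts H'.verts) :=
      ⟨fun _ _ h => h.symm⟩
    exact Set.pairwise_insert_of_symm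
  have key : ∃ P : Finset G.Subgraph, (∀ H ∈ P, H.IsKEdgePath 2) ∧
    (P : Set G.Subgraph).Pairwise (fun H H' => Disjoint H.verts H'.verts) ∧
    P.card = n ∧ ∀ H ∈ P, H.verts ⊆ S := by
    induction h with
    | nil => exact ⟨∅, by simp⟩
    | @cons S S' n a b c h2 hab hbc hac ha hb hc hs ha' hb' hc' ih =>
      obtain ⟨P, h1, h2, h3, h4⟩ := ih
      set w : G.Walk a c := .cons hab (.cons hbc .nil) with hw
      have hv : w.toSubgraph.verts = {a, b, c} := by
        ext x; simp [hw]; tauto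
      have hdis : ∀ H ∈ P, Disjoint w.toSubgraph.verts H.verts := by
        intro H hH
        rw [hv, Set.disjoint_left]
        rintro x (rfl | rfl | rfl) hx
        · exact ha (h4 H hH hx)
        · exact hb (h4 H hH hx)
        · exact hc (h4 H hH hx)
      have hn : w.toSubgraph ∉ P := by
        intro hP
        exact ha (h4 _ hP (by rw [hv]; simp))
      refine ⟨insert w.toSubgraph P, ?_, ?_, ?_, ?_⟩
      · intro H hH
        rcases Finset.mem_insert.1 hH with rfl | hH
        · refine ⟨a, c, w, ?_, ?_, rfl⟩
          · simp [hw, hab.ne, hbc.ne, hac]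
          · simp [hw]
        · exact h1 H hH
      · rw [Finset.coe_insert]
        refine (hpi P _).2 ⟨h2, ?_⟩
        intro H hH _
        exact hdis H hH
      · rw [Finset.card_insert_of_notMem hn, h3]
      · intro H hH
        rcases Finset.mem_insert.1 hH with rfl | hH
        · rw [hv]
          rintro x (rfl | rfl | rfl) <;> assumption
        · exact (h4 H hH).trans hs
  obtain ⟨P, h1, h2, h3, -⟩ := key
  exact le_csSup (bdd_lambda G) ⟨P, h1, h2, h3⟩

theorem pack_lambda {V : Type} [Fintype V] (G : SimpleGraph V) :
    PackT G Set.univ (G.lambdaK 2) := by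
  classical
  have hpi : ∀ (P : Finset G.Subgraph) (H : G.Subgraph),
      (insert H (P : Set G.Subgraph)).Pairwise (fun H H' => Disjoint H.verts H'.verts) ↔
      (P : Set G.Subgraph).Pairwise (fun H H' => Disjoint H.verts H'.verts) ∧
      ∀ H' ∈ (P : Set G.Subgraph), H ≠ H' → Disjoint H.verts H'.verts := by
    intro P H
    have : Std.Symm (fun H H' : G.Subgraph => Disjoint H.verts H'.verts) :=
      ⟨fun _ _ h => h.symm⟩
    exact Set.pairwise_insert_of_symm
  have hne : {n | ∃ P : Finset G.Subgraph, (∀ H ∈ P, H.IsKEdgePath 2) ∧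
    (P : Set G.Subgraph).Pairwise (fun H H' => Disjoint H.verts H'.verts) ∧
    P.card = n}.Nonempty := ⟨0, ∅, by simp⟩
  obtain ⟨P, h1, h2, h3⟩ := Nat.sSup_mem hne (bdd_lambda G)
  change P.card = G.lambdaK 2 at h3
  have key : ∀ P : Finset G.Subgraph, (∀ H ∈ P, H.IsKEdgePath 2) →
    (P : Set G.Subgraph).Pairwise (fun H H' => Disjoint H.verts H'.verts) →
    PackT G (⋃ H ∈ P, H.verts) P.card := by
    intro P
    induction P using Finset.induction_on with
    | empty => intro _ _; exact .nil _
    | insert H P hn ih =>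
      intro h1 h2
      rw [Finset.coe_insert, hpi] at h2
      have ih := ih (fun H hH => h1 H (Finset.mem_insert_of_mem hH)) h2.1
      obtain ⟨u, v, w, hw, hl, rfl⟩ := h1 H (Finset.mem_insert_self _ _)
      rw [Finset.card_insert_of_notMem hn]
      have hd : ∀ x ∈ w.support, x ∉ ⋃ H ∈ P, H.verts := by
        intro x hx h
        simp only [Set.mem_iUnion] at h
        obtain ⟨H, hH, hxH⟩ := h
        have := h2.2 H hH (by rintro rfl; exact hn hH)
        exact Set.disjoint_left.1 this (by simpa using hx) hxH
      have hin : ∀ x ∈ w.support, x ∈ ⋃ H ∈ insert w.toSubgraph P, H.verts := by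
        intro x hx
        simp only [Set.mem_iUnion]
        exact ⟨_, Finset.mem_insert_self _ _, by simpa using hx⟩
      have hsub : (⋃ H ∈ P, H.verts) ⊆ ⋃ H ∈ insert w.toSubgraph P, H.verts :=
        Set.biUnion_mono (fun H hH => Finset.mem_insert_of_mem hH) (fun _ _ => subset_rfl)
      match w, hw, hl, hd, hin, hsub with
      | .cons hab (.cons hbc .nil), hw, hl, hd, hin, hsub =>
        refine .cons ih hab hbc ?_ (hd _ (by simp)) (hd _ (by simp)) (hd _ (by simp)) hsub
          (hin _ (by simp)) (hin _ (by simp)) (hin _ (by simp))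
        rintro rfl
        simp at hw
  have := key P h1 h2
  rw [h3] at this
  exact this.mono (Set.subset_univ _)

structure Hyp {V : Type} [Fintype V] (s : ℕ) (G : SimpleGraph V) : Prop where
  hs : 4 ≤ s
  hdeg : ∀ v : V, 2 ≤ (G.neighborSet v).ncard ∧ (G.neighborSet v).ncard ≤ s
  hmin : ∀ e ∈ G.edgeSet, ∃ v : V, ((G.deleteEdges {e}).neighborSet v).ncard < 2
  hlam : (G.lambdaK 2 : ℚ) < (Fintype.card V : ℚ) / (s + 1)
  hsmaller : ∀ (V' : Type) [Fintype V'] (G' : SimpleGraph V'),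
      (∀ v : V', 2 ≤ (G'.neighborSet v).ncard ∧ (G'.neighborSet v).ncard ≤ s) →
      Fintype.card V' < Fintype.card V →
      (G'.lambdaK 2 : ℚ) ≥ (Fintype.card V' : ℚ) / (s + 1)

theorem Hyp.lam {V : Type} [Fintype V] {s : ℕ} {G : SimpleGraph V} (h : Hyp s G) :
    G.lambdaK 2 * (s + 1) < Fintype.card V := by
  have := h.hlam
  rw [lt_div_iff₀ (by positivity)] at this
  exact_mod_cast this

theorem Hyp.lemA {V : Type} [Fintype V] {s : ℕ} {G : SimpleGraph V} (h : Hyp s G)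
    (H : SimpleGraph V) (S : Set V) (hS : S.Nonempty)
    (hd : ∀ v ∉ S, 2 ≤ (H.neighborSet v \ S).ncard ∧ (H.neighborSet v \ S).ncard ≤ s) :
    ∃ n, PackT H Sᶜ n ∧ Fintype.card V ≤ n * (s + 1) + S.ncard := by
  classical
  have hc : Fintype.card ↥(Sᶜ) + S.ncard = Fintype.card V := by
    rw [← Nat.card_eq_fintype_card, ← Nat.card_eq_fintype_card, Nat.card_coe_set_eq, add_comm]
    exact Set.ncard_add_ncard_compl S
  have hpos : 0 < S.ncard := (Set.ncard_pos).2 hS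
  have := h.hsmaller ↥(Sᶜ) (H.induce Sᶜ) ?_ (by omega)
  · refine ⟨(H.induce Sᶜ).lambdaK 2, ?_, ?_⟩
    · refine ((pack_lambda (H.induce Sᶜ)).map (SimpleGraph.Embedding.induce Sᶜ)).mono ?_
      rintro _ ⟨x, -, rfl⟩
      exact x.2
    · rw [ge_iff_le, div_le_iff₀ (by positivity)] at this
      have : Fintype.card ↥(Sᶜ) ≤ (H.induce Sᶜ).lambdaK 2 * (s + 1) := by exact_mod_cast this
      omega
  · intro v
    have : ((H.induce Sᶜ).neighborSet v).ncard = (H.neighborSet v \ S).ncard := by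
      rw [← Set.ncard_image_of_injective _ Subtype.val_injective]
      congr 1
      ext x
      simp only [Set.mem_image, SimpleGraph.mem_neighborSet, SimpleGraph.comap_adj, Set.mem_sdiff]
      constructor
      · rintro ⟨y, hy, rfl⟩; exact ⟨hy, y.2⟩
      · rintro ⟨hx, hxS⟩; exact ⟨⟨x, hxS⟩, hx, rfl⟩
    rw [this]
    exact hd v v.2

theorem Hyp.lemB {V : Type} [Fintype V] {s : ℕ} {G : SimpleGraph V} (h : Hyp s G)
    (S : Set V) (hS : S.Nonempty) (m : ℕ) (hp : PackT G S m) (hm : S.ncard ≤ m * (s + 1))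
    (hd : ∀ v ∉ S, 2 ≤ (G.neighborSet v \ S).ncard) : False := by
  obtain ⟨n, hn, hc⟩ := h.lemA G S hS (fun v hv => ⟨hd v hv,
    (Set.ncard_le_ncard Set.sdiff_subset).trans (h.hdeg v).2⟩)
  have h1 := (hn.union hp disjoint_compl_left).le_lambda
  have h2 := h.lam
  have h3 := Nat.mul_le_mul_right (s + 1) h1
  rw [add_mul] at h3
  omega

theorem pack_list {V : Type} {G : SimpleGraph V} : ∀ (l : List V), l.IsChain G.Adj → l.Nodup →
    PackT G {v | v ∈ l} (l.length / 3)
  | [], _, _ => by simpa using .nil _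
  | [_], _, _ => by simpa using .nil _
  | [_, _], _, _ => by simpa using .nil _
  | a :: b :: c :: l, hc, hn => by
    have hl : (a :: b :: c :: l).length / 3 = l.length / 3 + 1 := by simp; omega
    rw [hl]
    simp only [List.isChain_cons_cons] at hc
    simp only [List.nodup_cons, List.mem_cons, not_or] at hn
    have hc' : l.IsChain G.Adj := hc.2.2.tail
    refine .cons (pack_list l hc' hn.2.2.2) hc.1 hc.2.1 hn.1.2.1 hn.1.2.2 hn.2.1.2 hn.2.2.1 ?_
      ?_ ?_ ?_
    · intro x hx; simp at hx ⊢; tauto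
    · simp
    · simp
    · simp

theorem ncard_list_le {V : Type} (l : List V) : {v | v ∈ l}.ncard ≤ l.length := by
  classical
  have : {v | v ∈ l} = (l.toFinset : Set V) := by ext; simp
  rw [this, Set.ncard_coe_finset]
  exact List.toFinset_card_le l

theorem Hyp.delList {V : Type} [Fintype V] {s : ℕ} {G : SimpleGraph V} (h : Hyp s G)
    (l : List V) (hc : l.IsChain G.Adj) (hn : l.Nodup) (hl : 3 ≤ l.length)
    (hd : ∀ v ∉ l, 2 ≤ (G.neighborSet v \ {v | v ∈ l}).ncard) : False := by
  refine h.lemB {v | v ∈ l} ?_ _ (pack_list l hc hn) ?_ hd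
  · match l, hl with
    | a :: l, _ => exact ⟨a, by simp⟩
  · refine (ncard_list_le l).trans ?_
    have := h.hs
    calc l.length ≤ (l.length / 3) * 5 := by omega
      _ ≤ _ := Nat.mul_le_mul_left _ (by omega)

theorem Hyp.lolli {V : Type} [Fintype V] {s : ℕ} {G : SimpleGraph V} (h : Hyp s G) :
    ∀ (k : ℕ) (x : V) (t : List V), Fintype.card V = (x :: t).length + k →
    (x :: t).IsChain G.Adj → (x :: t).Nodup → 3 ≤ (x :: t).length →
    (∀ a ∈ t, ∀ b, G.Adj a b → b ∈ x :: t) →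
    (G.neighborSet x \ {v | v ∈ x :: t}).ncard ≤ 1 → False := by
  intro k
  induction k with
  | zero => 
    intro x t hk hc hn hl ht hx
    refine h.delList _ hc hn hl ?_
    intro v hv
    exfalso
    have := (List.nodup_cons.2 ⟨hv, hn⟩).length_le_card
    simp at this hk
    omega
  | succ k ih =>
    intro x t hk hc hn hl ht hx
    by_cases hz : ∃ z, z ∉ x :: t ∧ G.Adj x z ∧ (G.neighborSet z).ncard = 2
    · obtain ⟨z, hz, hxz, hz2⟩ := hz
      refine ih z (x :: t) (by simp at hk ⊢; omega) ?_ (List.nodup_cons.2 ⟨hz, hn⟩)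
        (by simp at hl ⊢; omega) ?_ ?_
      · rw [List.isChain_cons_cons]; exact ⟨hxz.symm, hc⟩
      · intro a ha b hab
        rcases List.mem_cons.1 ha with rfl | ha
        · by_cases hb : b ∈ a :: t
          · exact List.mem_cons_of_mem _ hb
          · have := (Set.ncard_le_one).1 hx b ⟨hab, hb⟩ z ⟨hxz, hz⟩
            rw [this]; exact List.mem_cons_self
        · exact List.mem_cons_of_mem _ (ht a ha b hab)
      · have hsub : G.neighborSet z \ {v | v ∈ z :: x :: t} ⊆ G.neighborSet z \ {x} := by
          rintro y ⟨hy, hy'⟩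
          refine ⟨hy, ?_⟩
          rintro rfl
          simp at hy'
        have := Set.ncard_le_ncard hsub
        rw [Set.ncard_sdiff_singleton_of_mem (by exact hxz.symm)] at this
        omega
    · refine h.delList _ hc hn hl ?_
      intro v hv
      have hsub : G.neighborSet v \ {x} ⊆ G.neighborSet v \ {v | v ∈ x :: t} := by
        rintro y ⟨hy, hy'⟩
        refine ⟨hy, ?_⟩
        intro hyt
        rcases List.mem_cons.1 hyt with rfl | hyt
        · exact hy' rfl
        · exact hv (ht y hyt v (SimpleGraph.Adj.symm hy))
      refine le_trans ?_ (Set.ncard_le_ncard hsub)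
      by_cases hvx : G.Adj x v
      · rw [Set.ncard_sdiff_singleton_of_mem (by exact hvx.symm)]
        have h1 := (h.hdeg v).1
        have h2 : (G.neighborSet v).ncard ≠ 2 := fun h2 => hz ⟨v, hv, hvx, h2⟩
        omega
      · rw [Set.sdiff_singleton_eq_self (by exact fun h => hvx (SimpleGraph.Adj.symm h))]
        exact (h.hdeg v).1

theorem Hyp.lolli2 {V : Type} [Fintype V] {s : ℕ} {G : SimpleGraph V} (h : Hyp s G)
    (x : V) (t : List V) (hc : (x :: t).IsChain G.Adj) (hn : (x :: t).Nodup) (hl : 3 ≤ t.length)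
    (ht : ∀ a ∈ t, ∀ b, G.Adj a b → b ∈ x :: t) : False := by
  by_cases hx : (G.neighborSet x \ {v | v ∈ x :: t}).ncard ≤ 1
  · have hle := hn.length_le_card
    exact h.lolli (Fintype.card V - (x :: t).length) x t (by omega) hc hn (by simp; omega) ht hx
  · refine h.delList t hc.tail (List.nodup_cons.1 hn).2 hl ?_
    intro v hv
    by_cases hvx : v = x
    · subst hvx
      refine le_trans (by omega : 2 ≤ (G.neighborSet v \ {u | u ∈ v :: t}).ncard)
        (Set.ncard_le_ncard ?_)
      rintro y ⟨hy, hy'⟩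
      exact ⟨hy, fun h => hy' (List.mem_cons_of_mem _ h)⟩
    · refine le_trans (h.hdeg v).1 (Set.ncard_le_ncard ?_)
      intro y hy
      refine ⟨hy, fun hyt => ?_⟩
      rcases List.mem_cons.1 (ht y hyt v (SimpleGraph.Adj.symm hy)) with h | h
      exacts [hvx h, hv h]

theorem nbr_two {V : Type} [Fintype V] {G : SimpleGraph V} {a b c : V}
    (h : (G.neighborSet b).ncard = 2) (hba : G.Adj b a) (hbc : G.Adj b c) (hac : a ≠ c) :
    ∀ x, G.Adj b x → x = a ∨ x = c := by
  have hsub : ({a, c} : Set V) ⊆ G.neighborSet b := by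
    rintro x (rfl | rfl) <;> assumption
  have := Set.eq_of_subset_of_ncard_le hsub (by rw [h, Set.ncard_pair hac])
  intro x hx
  have hx : x ∈ G.neighborSet b := hx
  rw [← this] at hx
  simpa using hx

theorem Hyp.min_edge {V : Type} [Fintype V] {s : ℕ} {G : SimpleGraph V} (h : Hyp s G) {a b : V}
    (hab : G.Adj a b) : (G.neighborSet a).ncard = 2 ∨ (G.neighborSet b).ncard = 2 := by
  obtain ⟨v, hv⟩ := h.hmin s(a, b) hab
  have hd := (h.hdeg v).1
  by_cases hva : v = a
  · subst hva
    left
    have hsub : G.neighborSet v \ {b} ⊆ (G.deleteEdges {s(v, b)}).neighborSet v := by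
      rintro y ⟨hy, hy'⟩
      have hy : G.Adj v y := hy
      simp only [Set.mem_singleton_iff] at hy'
      simp [hy, hy', hab.ne]
    have := Set.ncard_le_ncard hsub
    rw [Set.ncard_sdiff_singleton_of_mem (by exact hab)] at this
    omega
  by_cases hvb : v = b
  · subst hvb
    right
    have hsub : G.neighborSet v \ {a} ⊆ (G.deleteEdges {s(a, v)}).neighborSet v := by
      rintro y ⟨hy, hy'⟩
      have hy : G.Adj v y := hy
      simp only [Set.mem_singleton_iff] at hy'
      simp [hy, hy', hab.ne']
    have := Set.ncard_le_ncard hsub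
    rw [Set.ncard_sdiff_singleton_of_mem (by exact hab.symm)] at this
    omega
  exfalso
  have hsub : G.neighborSet v ⊆ (G.deleteEdges {s(a, b)}).neighborSet v := by
    intro y hy
    have hy : G.Adj v y := hy
    simp [hy, hva, hvb]
  have := Set.ncard_le_ncard hsub
  omega

theorem pack_contract {V : Type} {G H : SimpleGraph V} {p0 p1 p2 p3 p4 : V}
    (hH : ∀ a b, H.Adj a b → G.Adj a b ∨ (a = p0 ∧ b = p4) ∨ (a = p4 ∧ b = p0))
    (h01 : G.Adj p0 p1) (h12 : G.Adj p1 p2) (h23 : G.Adj p2 p3) (h34 : G.Adj p3 p4)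
    (hn : [p0, p1, p2, p3, p4].Nodup) {T : Set V} {n : ℕ} (h : PackT H T n)
    (hT1 : p1 ∉ T) (hT2 : p2 ∉ T) (hT3 : p3 ∉ T) :
    PackT G T n ∨ (p0 ∈ T ∧ PackT G (T ∪ {p1, p2, p3}) (n + 1)) := by
  simp only [List.nodup_cons, List.mem_cons, not_or, List.not_mem_nil] at hn
  induction h with
  | nil => exact Or.inl (.nil _)
  | @cons S S' n a b c h2 hab hbc hac ha hb hc hs ha' hb' hc' ih =>
    have ih := ih (fun h => hT1 (hs h)) (fun h => hT2 (hs h)) (fun h => hT3 (hs h))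
    have key : ∀ a b c : V, a ∉ S → b ∉ S → c ∉ S → a ∈ S' → b ∈ S' → c ∈ S' → a ≠ c →
        H.Adj b c → PackT G S n → ((a = p0 ∧ b = p4) ∨ (a = p4 ∧ b = p0)) →
        PackT G (S' ∪ {p1, p2, p3}) (n + 1 + 1) := by
      intro a b c ha hb hc ha' hb' hc' hac hbc hP hor
      have hbc' : G.Adj b c := by
        rcases hH _ _ hbc with h | h | h
        · exact h
        · grind
        · grind
      have hd : ∀ x ∈ S', x ≠ p1 ∧ x ≠ p2 ∧ x ≠ p3 := by
        intro x hx
        refine ⟨?_, ?_, ?_⟩ <;> rintro rfl <;> contradiction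
      have h1 := hd a ha'
      have h2 := hd b hb'
      have h3 := hd c hc'
      have hbcn := hbc.ne
      have hS1 : p1 ∉ S := fun h => hT1 (hs h)
      have hS2 : p2 ∉ S := fun h => hT2 (hs h)
      have hS3 : p3 ∉ S := fun h => hT3 (hs h)
      rcases hor with ⟨rfl, rfl⟩ | ⟨rfl, rfl⟩
      · have q : PackT G (S ∪ {a, p1, p2}) (n + 1) :=
          .cons hP h01 h12 (by grind) ha hS1 hS2 Set.subset_union_left
            (by simp) (by simp) (by simp)
        refine .cons q h34 hbc' (by grind) ?_ ?_ ?_ ?_ ?_ ?_ ?_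
        · simp; grind
        · simp; grind
        · simp; grind
        · rintro x (hx | hx | hx | hx)
          · exact Or.inl (hs hx)
          all_goals grind
        all_goals grind
      · have q : PackT G (S ∪ {a, p3, p2}) (n + 1) :=
          .cons hP h34.symm h23.symm (by grind) ha hS3 hS2 Set.subset_union_left
            (by simp) (by simp) (by simp)
        refine .cons q h01.symm hbc' (by grind) ?_ ?_ ?_ ?_ ?_ ?_ ?_
        · simp; grind
        · simp; grind
        · simp; grind
        · rintro x (hx | hx | hx | hx)
          · exact Or.inl (hs hx)
          all_goals grind
        all_goals grind
    rcases ih with ih | ⟨hp0, ih⟩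
    · rcases hH _ _ hab with hab' | hab'
      · rcases hH _ _ hbc with hbc' | hbc'
        · exact Or.inl (.cons ih hab' hbc' hac ha hb hc hs ha' hb' hc')
        · exact Or.inr ⟨by grind, key c b a hc hb ha hc' hb' ha' hac.symm hab.symm ih (by grind)⟩
      · exact Or.inr ⟨by grind, key a b c ha hb hc ha' hb' hc' hac hbc ih hab'⟩
    · right
      have hab' : G.Adj a b := by
        rcases hH _ _ hab with h | h | h
        · exact h
        · exact absurd hp0 (h.1 ▸ ha)
        · exact absurd hp0 (h.2 ▸ hb)
      have hbc' : G.Adj b c := by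
        rcases hH _ _ hbc with h | h | h
        · exact h
        · exact absurd hp0 (h.1 ▸ hb)
        · exact absurd hp0 (h.2 ▸ hc)
      refine ⟨hs hp0, .cons ih hab' hbc' hac ?_ ?_ ?_ (Set.union_subset_union_left _ hs)
        (Or.inl ha') (Or.inl hb') (Or.inl hc')⟩
      all_goals grind

theorem Hyp.contract {V : Type} [Fintype V] {s : ℕ} {G : SimpleGraph V} (h : Hyp s G)
    {p0 p1 p2 p3 p4 : V}
    (h01 : G.Adj p0 p1) (h12 : G.Adj p1 p2) (h23 : G.Adj p2 p3) (h34 : G.Adj p3 p4)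
    (hn : [p0, p1, p2, p3, p4].Nodup)
    (d1 : (G.neighborSet p1).ncard = 2) (d2 : (G.neighborSet p2).ncard = 2)
    (d3 : (G.neighborSet p3).ncard = 2) (hna : ¬ G.Adj p0 p4) : False := by
  have hn' := hn
  simp only [List.nodup_cons, List.mem_cons, not_or, List.not_mem_nil] at hn'
  have n1 := nbr_two d1 h01.symm h12 (by grind)
  have n2 := nbr_two d2 h12.symm h23 (by grind)
  have n3 := nbr_two d3 h23.symm h34 (by grind)
  set H : SimpleGraph V := G ⊔ SimpleGraph.edge p0 p4 with hHdef
  have hHadj : ∀ a b, H.Adj a b ↔ G.Adj a b ∨ (a = p0 ∧ b = p4) ∨ (a = p4 ∧ b = p0) := by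
    intro a b
    rw [hHdef, SimpleGraph.sup_adj, SimpleGraph.edge_adj]
    grind
  have hcard : ∀ v ∉ ({p1, p2, p3} : Set V),
      (H.neighborSet v \ {p1, p2, p3}).ncard = (G.neighborSet v).ncard := by
    intro v hv
    simp only [Set.mem_insert_iff, Set.mem_singleton_iff, not_or] at hv
    have hsymm : ∀ a b, G.Adj a b → G.Adj b a := fun a b h => h.symm
    have gen : ∀ q r : V, q ≠ r → G.Adj v q → ¬ G.Adj v r → 
        H.neighborSet v \ {p1, p2, p3} = insert r (G.neighborSet v \ {q}) →
        (H.neighborSet v \ {p1, p2, p3}).ncard = (G.neighborSet v).ncard := by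
      intro q r hqr hq hr he
      rw [he, Set.ncard_insert_of_notMem (by simp [hr]),
        Set.ncard_sdiff_singleton_of_mem (by exact hq)]
      have := (h.hdeg v).1
      omega
    by_cases hv0 : v = p0
    · refine gen p1 p4 (by grind) (by grind) (by grind) ?_
      ext y
      simp only [Set.mem_sdiff, SimpleGraph.mem_neighborSet, hHadj, Set.mem_insert_iff,
        Set.mem_singleton_iff]
      grind
    by_cases hv4 : v = p4
    · refine gen p3 p0 (by grind) (by grind) (by grind) ?_
      ext y
      simp only [Set.mem_sdiff, SimpleGraph.mem_neighborSet, hHadj, Set.mem_insert_iff,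
        Set.mem_singleton_iff]
      grind
    congr 1
    ext y
    simp only [Set.mem_sdiff, SimpleGraph.mem_neighborSet, hHadj, Set.mem_insert_iff,
        Set.mem_singleton_iff]
    grind
  obtain ⟨n, hP, hc⟩ := h.lemA H {p1, p2, p3} ⟨p1, by simp⟩
    (fun v hv => by rw [hcard v hv]; exact h.hdeg v)
  have hfin : PackT G Set.univ (n + 1) := by
    rcases pack_contract (fun a b => (hHadj a b).1) h01 h12 h23 h34 hn hP (by simp) (by simp)
      (by simp) with hq | ⟨-, hq⟩
    · exact .cons hq h12 h23 (by grind) (by simp) (by simp) (by simp) (Set.subset_univ _)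
        trivial trivial trivial
    · exact hq.mono (Set.subset_univ _)
  have h1 := hfin.le_lambda
  have h2 := h.lam
  have h3 := Nat.mul_le_mul_right (s + 1) h1
  have h4 : ({p1, p2, p3} : Set V).ncard ≤ 3 := Set.ncard_insert_le _ _ |>.trans (by
    have := Set.ncard_insert_le p2 {p3}
    simp at this ⊢; omega)
  have := h.hs
  rw [add_mul] at h3
  omega

theorem Hyp.core {V : Type} [Fintype V] {s : ℕ} {G : SimpleGraph V} (h : Hyp s G)
    {p0 p1 p2 p3 p4 : V}
    (h01 : G.Adj p0 p1) (h12 : G.Adj p1 p2) (h23 : G.Adj p2 p3) (h34 : G.Adj p3 p4)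
    (hn1 : [p0, p1, p2, p3].Nodup) (hn2 : [p1, p2, p3, p4].Nodup)
    (d1 : (G.neighborSet p1).ncard = 2) (d2 : (G.neighborSet p2).ncard = 2)
    (d3 : (G.neighborSet p3).ncard = 2) : False := by
  simp only [List.nodup_cons, List.mem_cons, not_or, List.not_mem_nil] at hn1 hn2
  have n1 := nbr_two d1 h01.symm h12 (by grind)
  have n2 := nbr_two d2 h12.symm h23 (by grind)
  have n3 := nbr_two d3 h23.symm h34 (by grind)
  have h10 := h01.symm
  have h21 := h12.symm
  have h32 := h23.symm
  have h43 := h34.symm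
  by_cases he : p0 = p4
  · subst he
    refine h.lolli2 p0 [p1, p2, p3] ?_ ?_ (by simp) ?_
    · simp [*]
    · simp; grind
    · simp only [List.mem_cons, List.not_mem_nil]; grind
  by_cases ha : G.Adj p0 p4
  · have ha' := ha.symm
    rcases h.min_edge ha with d | d
    · have n4 := nbr_two d h01 ha (by grind)
      refine h.lolli2 p4 [p3, p2, p1, p0] ?_ ?_ (by simp) ?_
      · simp [*]
      · simp; grind
      · simp only [List.mem_cons, List.not_mem_nil]; grind
    · have n4 := nbr_two d h43 ha' (by grind)
      refine h.lolli2 p0 [p1, p2, p3, p4] ?_ ?_ (by simp) ?_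
      · simp [*]
      · simp; grind
      · simp only [List.mem_cons, List.not_mem_nil]; grind
  · refine h.contract h01 h12 h23 h34 ?_ d1 d2 d3 ha
    simp; grind

theorem two_path_mid {V : Type} [Fintype V] {G : SimpleGraph V} {a b c : V} (hab : G.Adj a b)
    (hbc : G.Adj b c) (hac : a ≠ c) (v : V)
    (hv : ((SimpleGraph.Walk.cons hab (.cons hbc .nil)).toSubgraph.neighborSet v).ncard = 2) :
    v = b := by
  by_contra hvb
  have hsub : (SimpleGraph.Walk.cons hab (.cons hbc .nil)).toSubgraph.neighborSet v ⊆ {b} := by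
    intro u hu
    simp at hu ⊢
    grind
  have := Set.ncard_le_ncard hsub
  rw [Set.ncard_singleton] at this
  omega

theorem Hyp.long {V : Type} [Fintype V] {s : ℕ} {G : SimpleGraph V} (h : Hyp s G) {x y : V}
    (w : G.Walk x y) (hl : 4 ≤ w.length) (hn : w.support.tail.Nodup)
    (hx : x = y ∨ w.support.Nodup)
    (hd : ∀ i, i ≠ 0 → i < w.length → (G.neighborSet (w.getVert i)).ncard = 2) : False := by
  match w, hl, hn, hx, hd with
  | .cons h1 (.cons h2 (.cons h3 (.cons h4 w'))), hl, hn, hx, hd =>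
    have d1 := hd 1 (by simp) (by omega)
    have d2 := hd 2 (by simp) (by omega)
    have d3 := hd 3 (by simp) (by omega)
    simp at d1 d2 d3
    simp only [SimpleGraph.Walk.support_cons, List.tail_cons] at hn hx
    have hs := w'.start_mem_support
    have he := w'.end_mem_support
    simp only [List.nodup_cons, List.mem_cons, not_or] at hn hx
    refine h.core h1 h2 h3 h4 ?_ ?_ d1 d2 d3
    · simp; grind
    · simp; grind

theorem other_nbr {V : Type} [Fintype V] {G : SimpleGraph V} {a b : V}
    (h : (G.neighborSet b).ncard = 2) : ∃ c, c ≠ a ∧ G.Adj b c := by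
  by_contra! hc
  have hsub : G.neighborSet b ⊆ {a} := by
    intro c hbc
    by_contra hca
    exact hc c hca hbc
  have := Set.ncard_le_ncard hsub
  rw [Set.ncard_singleton] at this
  omega

/-- Let `s ≥ 4` and let `G` be a finite simple connected graph such that:
(1) every vertex of `G` has degree at least 2 and at most `s`, and deleting any
edge of `G` creates a vertex of degree less than 2 (minimality);
(2) `λ(G) < v(G)/(s+1)`; and
(3) every graph `G'` with all vertex degrees between 2 and `s` and fewer vertices
than `G` satisfies `λ(G') ≥ v(G')/(s+1)`.
Then every thread of `G` has either 2 or 3 edges. -/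
theorem stmt_12 {V : Type} [Fintype V] (s : ℕ) (hs : 4 ≤ s)
    (G : SimpleGraph V) (hconn : G.Connected)
    (hdeg : ∀ v : V, 2 ≤ (G.neighborSet v).ncard ∧ (G.neighborSet v).ncard ≤ s)
    (hmin : ∀ e ∈ G.edgeSet, ∃ v : V, ((G.deleteEdges {e}).neighborSet v).ncard < 2)
    (hlam : (G.lambdaK 2 : ℚ) < (Fintype.card V : ℚ) / (s + 1))
    (hsmaller : ∀ (V' : Type) [Fintype V'] (G' : SimpleGraph V'),
      (∀ v : V', 2 ≤ (G'.neighborSet v).ncard ∧ (G'.neighborSet v).ncard ≤ s) →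
      Fintype.card V' < Fintype.card V →
      (G'.lambdaK 2 : ℚ) ≥ (Fintype.card V' : ℚ) / (s + 1)) :
    ∀ (x y : V) (w : G.Walk x y), G.IsThread w → w.length = 2 ∨ w.length = 3 := by
  have h : Hyp s G := ⟨hs, hdeg, hmin, hlam, hsmaller⟩
  intro x y w hw
  rcases hw with ⟨hp, hd, hmax⟩ | ⟨rfl, hcyc, hd⟩
  · match w, hp, hd, hmax with
    | .nil, hp, hd, hmax =>
      exfalso
      have : (G.neighborSet x).Nonempty := by
        rw [← Set.ncard_pos]; have := (hdeg x).1; omega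
      obtain ⟨z, hz⟩ := this
      have hz : G.Adj x z := hz
      have := hmax x z (.cons hz .nil) (by simp [hz.ne]) ?_ ?_
      · have := congrArg (fun H => z ∈ H.verts) this
        simp [hz.ne'] at this
      · intro v hv
        exfalso
        classical
        have hsub : (SimpleGraph.Walk.cons hz .nil).toSubgraph.neighborSet v ⊆
            {if v = x then z else x} := by
          intro u hu
          simp at hu
          grind
        have := Set.ncard_le_ncard hsub
        rw [Set.ncard_singleton] at this
        omega
      · simp
    | .cons hxy .nil, hp, hd, hmax =>
      exfalso
      rcases h.min_edge hxy with d | d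
      · obtain ⟨z, hz, hxz⟩ := other_nbr (a := y) d
        have := hmax z y (.cons hxz.symm (.cons hxy .nil))
          (by simp [hxz.ne', hxy.ne, hz])
          (fun v hv => two_path_mid hxz.symm hxy hz v hv ▸ d) (by simp)
        have := congrArg (fun H => z ∈ H.verts) this
        simp [hxz.ne', hz] at this
      · obtain ⟨z, hz, hxz⟩ := other_nbr (a := x) d
        have := hmax x z (.cons hxy (.cons hxz .nil))
          (by simp [hxz.ne, hxy.ne, hz.symm])
          (fun v hv => two_path_mid hxy hxz hz.symm v hv ▸ d) ?_
        · have := congrArg (fun H => z ∈ H.verts) this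
          simp [hxz.ne', hz] at this
        · simp
    | .cons h1 (.cons h2 .nil), hp, hd, hmax => simp
    | .cons h1 (.cons h2 (.cons h3 .nil)), hp, hd, hmax => simp
    | .cons h1 (.cons h2 (.cons h3 (.cons h4 w'))), hp, hd, hmax =>
      exfalso
      refine h.long _ (by simp) hp.support_nodup.tail (Or.inr hp.support_nodup) ?_
      intro i hi hi'
      exact hd _ (hp.ncard_neighborSet_toSubgraph_internal_eq_two hi hi')
  · rw [SimpleGraph.Walk.copy_rfl_rfl] at hcyc
    have hl := hcyc.three_le_length
    by_contra hne
    refine h.long w (by omega) hcyc.support_nodup (Or.inl rfl) ?_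
    intro i hi hi'
    refine hd _ (w.getVert_mem_support i) ?_
    intro he
    rcases (hcyc.getVert_endpoint_iff hi'.le).1 he with h | h <;> omega
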